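/- Let H ∈ (1/2, 1), α > 0. Then there exists a constant C > 0 depending only on α and H such that for all T > 0, | (1/(4T)) ∫_{(0,T)⁴} m_H(x₁,x₂,x₃,x₄) dx₁dx₂dx₃dx₄ − H^{4H−2}(2H−1)² ∫_{(0,∞)³} F(y₁,y₂,y₃) dy₁dy₂dy₃ | ≤ C/T. -/

import Mathlib

open MeasureTheory Real Set

/-- The kernel r_H. -/
noncomputable def rker (H w z : ℝ) : ℝ :=
  H ^ (2 * H - 1) * (2 * H - 1) * (Real.exp (w / H) * Real.exp (z / H)) ^ (1 - H) *
    |Real.exp (w / H) - Real.exp (z / H)| ^ (2 * H - 2)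

/-- The function m_H. -/
noncomputable def mker (H α x₁ x₂ x₃ x₄ : ℝ) : ℝ :=
  Real.exp (-α * |x₁ - x₃|) * Real.exp (-α * |x₂ - x₄|) *
    rker H x₁ x₂ * rker H x₃ x₄

/-- The function F of the paper. -/
noncomputable def Ffun (H α y₁ y₂ y₃ : ℝ) : ℝ :=
  Real.exp (-α * |y₁ - y₃|) * Real.exp (-α * y₂) *
    Real.exp ((1 - 1 / H) * (y₁ + y₂ + y₃)) *
    |Real.exp (-y₂ / H) - Real.exp (-y₃ / H)| ^ (2 * H - 2) *
    |1 - Real.exp (-y₁ / H)| ^ (2 * H - 2)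

instance isAddHaarMeasure_volume_real_three :
    (volume : Measure (ℝ × ℝ × ℝ)).IsAddHaarMeasure :=
  Measure.prod.instIsAddHaarMeasure volume volume

instance isAddHaarMeasure_volume_real_four :
    (volume : Measure (ℝ × ℝ × ℝ × ℝ)).IsAddHaarMeasure :=
  Measure.prod.instIsAddHaarMeasure volume volume

/-- A linear involution preserves Lebesgue (Haar) measure. -/
theorem measurePreserving_of_linear_involutive {E : Type*} [NormedAddCommGroup E]
    [NormedSpace ℝ E] [MeasurableSpace E] [BorelSpace E] [FiniteDimensional ℝ E]
    (μ : Measure E) [μ.IsAddHaarMeasure] (f : E →ₗ[ℝ] E) (hf : Function.Involutive f) :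
    MeasurePreserving f μ μ := by
  have hsq : LinearMap.det f * LinearMap.det f = 1 := by
    rw [← LinearMap.det_comp, show f ∘ₗ f = LinearMap.id from LinearMap.ext hf, LinearMap.det_id]
  have hne : LinearMap.det f ≠ 0 := fun h => by simp [h] at hsq
  refine ⟨f.continuous_of_finiteDimensional.measurable, ?_⟩
  rw [Measure.map_linearMap_addHaar_eq_smul_addHaar μ hne]
  rcases mul_self_eq_one_iff.1 hsq with h | h <;> simp [h]

theorem measurableEmbedding_of_linear_involutive {E : Type*} [NormedAddCommGroup E]
    [NormedSpace ℝ E] [MeasurableSpace E] [BorelSpace E] [FiniteDimensional ℝ E]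
    (f : E →ₗ[ℝ] E) (hf : Function.Involutive f) : MeasurableEmbedding f :=
  (MeasurableEquiv.ofInvolutive f hf
    f.continuous_of_finiteDimensional.measurable).measurableEmbedding

theorem integral_comp_of_linear_involutive {E : Type*} [NormedAddCommGroup E]
    [NormedSpace ℝ E] [MeasurableSpace E] [BorelSpace E] [FiniteDimensional ℝ E]
    (μ : Measure E) [μ.IsAddHaarMeasure] (f : E →ₗ[ℝ] E) (hf : Function.Involutive f)
    (g : E → ℝ) : ∫ x, g (f x) ∂μ = ∫ x, g x ∂μ :=
  (measurePreserving_of_linear_involutive μ f hf).integral_comp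
    (measurableEmbedding_of_linear_involutive f hf) g

theorem integrable_comp_of_linear_involutive {E : Type*} [NormedAddCommGroup E]
    [NormedSpace ℝ E] [MeasurableSpace E] [BorelSpace E] [FiniteDimensional ℝ E]
    (μ : Measure E) [μ.IsAddHaarMeasure] (f : E →ₗ[ℝ] E) (hf : Function.Involutive f)
    (g : E → ℝ) : Integrable (fun x => g (f x)) μ ↔ Integrable g μ :=
  (measurePreserving_of_linear_involutive μ f hf).integrable_comp_emb
    (measurableEmbedding_of_linear_involutive f hf)

theorem ae_linear_ne_zero {E : Type*} [NormedAddCommGroup E]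
    [NormedSpace ℝ E] [MeasurableSpace E] [BorelSpace E] [FiniteDimensional ℝ E]
    (μ : Measure E) [μ.IsAddHaarMeasure] (l : E →ₗ[ℝ] ℝ) (hl : l ≠ 0) :
    ∀ᵐ x ∂μ, l x ≠ 0 := by
  have h := Measure.addHaar_submodule μ (LinearMap.ker l) (by rwa [Ne, LinearMap.ker_eq_top])
  exact measure_mono_null (fun x hx => by simpa using hx) h

theorem integrable_comp_abs {f : ℝ → ℝ} (hf : IntegrableOn f (Ioi 0)) :
    Integrable (fun x => f |x|) := by
  have hpos : IntegrableOn (fun x => f |x|) (Ioi 0) :=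
    hf.congr_fun (fun x hx => by rw [abs_of_pos hx]) measurableSet_Ioi
  have hneg : IntegrableOn (fun x => f |x|) (Iic 0) := by
    have h := (integrableOn_Ici_iff_integrableOn_Ioi).2 hpos
    have := h.comp_neg
    simpa using this
  rw [← integrableOn_univ, ← Iic_union_Ioi (a := (0 : ℝ))]
  exact hneg.union hpos

/-- The even, stationary form of `rker`, up to its constant. -/
noncomputable def stationaryKernel (H u : ℝ) : ℝ :=
  Real.exp ((1 - 1 / H) * |u|) * (1 - Real.exp (-|u| / H)) ^ (2 * H - 2)

theorem stationaryKernel_neg (H u : ℝ) : stationaryKernel H (-u) = stationaryKernel H u := by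
  simp [stationaryKernel]

theorem one_sub_exp_neg_abs_div_nonneg {H : ℝ} (hH : 0 < H) (u : ℝ) :
    0 ≤ 1 - Real.exp (-|u| / H) := by
  have : -|u| / H ≤ 0 := div_nonpos_of_nonpos_of_nonneg (by simp) hH.le
  simpa using Real.exp_le_one_iff.2 this

theorem stationaryKernel_nonneg {H : ℝ} (hH : 0 < H) (u : ℝ) : 0 ≤ stationaryKernel H u :=
  mul_nonneg (Real.exp_pos _).le (Real.rpow_nonneg (one_sub_exp_neg_abs_div_nonneg hH u) _)

theorem measurable_stationaryKernel (H : ℝ) : Measurable (stationaryKernel H) := by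
  unfold stationaryKernel
  fun_prop

theorem exp_mul_abs_exp_sub_exp_rpow {H : ℝ} (hH : 0 < H) (a b : ℝ) :
    Real.exp ((1 / H - 1) * (a + b)) * |Real.exp (a / H) - Real.exp (b / H)| ^ (2 * H - 2) =
      stationaryKernel H (a - b) := by
  wlog hab : b ≤ a generalizing a b
  · rw [← neg_sub b a, stationaryKernel_neg, ← this b a (le_of_not_ge hab), add_comm b a,
      abs_sub_comm]
  have hfac : Real.exp (a / H) - Real.exp (b / H) =
      Real.exp (a / H) * (1 - Real.exp (-|a - b| / H)) := by
    rw [mul_sub, ← Real.exp_add, abs_of_nonneg (sub_nonneg.2 hab)]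
    ring_nf
  have hnn := one_sub_exp_neg_abs_div_nonneg hH (a - b)
  rw [hfac, abs_of_nonneg (mul_nonneg (Real.exp_pos _).le hnn),
    Real.mul_rpow (Real.exp_pos _).le hnn, ← Real.exp_mul, ← mul_assoc, ← Real.exp_add,
    stationaryKernel, abs_of_nonneg (sub_nonneg.2 hab)]
  congr 2
  field_simp
  ring

theorem rker_eq_stationaryKernel {H : ℝ} (hH : 0 < H) (w z : ℝ) :
    rker H w z = H ^ (2 * H - 1) * (2 * H - 1) * stationaryKernel H (w - z) := by
  rw [rker, mul_assoc, ← exp_mul_abs_exp_sub_exp_rpow hH, ← Real.exp_add, ← Real.exp_mul]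
  rw [show (w / H + z / H) * (1 - H) = (1 / H - 1) * (w + z) by field_simp]

theorem mker_eq {H : ℝ} (hH : 0 < H) (α x₁ x₂ x₃ x₄ : ℝ) :
    mker H α x₁ x₂ x₃ x₄ = H ^ (4 * H - 2) * (2 * H - 1) ^ 2 *
      (Real.exp (-α * |x₁ - x₃|) * Real.exp (-α * |x₂ - x₄|) *
        stationaryKernel H (x₁ - x₂) * stationaryKernel H (x₃ - x₄)) := by
  rw [mker, rker_eq_stationaryKernel hH, rker_eq_stationaryKernel hH,
    show 4 * H - 2 = (2 * H - 1) + (2 * H - 1) by ring, Real.rpow_add hH]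
  ring

theorem Ffun_eq {H : ℝ} (hH : 0 < H) (α y₁ y₂ y₃ : ℝ) :
    Ffun H α y₁ y₂ y₃ = Real.exp (-α * |y₁ - y₃|) * Real.exp (-α * y₂) *
      stationaryKernel H y₁ * stationaryKernel H (y₂ - y₃) := by
  have h₁' := exp_mul_abs_exp_sub_exp_rpow hH 0 (-y₁)
  have h₂ := exp_mul_abs_exp_sub_exp_rpow hH (-y₂) (-y₃)
  rw [zero_div, Real.exp_zero, sub_neg_eq_add, zero_add, zero_add] at h₁'
  rw [← stationaryKernel_neg H (y₂ - y₃), show -(y₂ - y₃) = -y₂ - -y₃ by ring, ← h₁', ← h₂, Ffun,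
    show (1 - 1 / H) * (y₁ + y₂ + y₃) = (1 / H - 1) * -y₁ + (1 / H - 1) * (-y₂ + -y₃) by ring,
    Real.exp_add]
  ring

theorem mker_sub {H : ℝ} (hH : 0 < H) (α t y₁ y₂ y₃ : ℝ) (h₂ : 0 < y₂) :
    mker H α t (t - y₁) (t - y₂) (t - y₃) =
      H ^ (4 * H - 2) * (2 * H - 1) ^ 2 * Ffun H α y₁ y₂ y₃ := by
  rw [mker_eq hH, Ffun_eq hH, ← stationaryKernel_neg H (y₂ - y₃),
    show t - (t - y₂) = y₂ by ring, show t - (t - y₁) = y₁ by ring, abs_of_pos h₂,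
    show t - y₁ - (t - y₃) = -(y₁ - y₃) by ring, abs_neg,
    show t - y₂ - (t - y₃) = -(y₂ - y₃) by ring]
  ring

theorem measurable_Ffun (H α : ℝ) :
    Measurable (fun q : ℝ × ℝ × ℝ => Ffun H α q.1 q.2.1 q.2.2) := by
  unfold Ffun
  fun_prop

theorem stationaryKernel_le {H : ℝ} (hH : 0 < H) (hH1 : H < 1) {u : ℝ} (hu : 0 < u) :
    stationaryKernel H u ≤
      Real.exp ((1 - 1 / H) * u) * ((u / H) ^ (2 * H - 2) * (1 + u / H) ^ 2) := by
  have hx : 0 < u / H := div_pos hu hH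
  have hlow : (u / H) / (1 + u / H) ≤ 1 - Real.exp (-u / H) := by
    have h := Real.add_one_le_exp (u / H)
    rw [neg_div, Real.exp_neg, div_le_iff₀ (by positivity)]
    have h2 : (Real.exp (u / H))⁻¹ * (1 + u / H) ≤ 1 := by
      rw [inv_mul_le_iff₀ (Real.exp_pos _)]
      linarith
    linarith
  rw [stationaryKernel, abs_of_pos hu]
  gcongr
  calc (1 - Real.exp (-u / H)) ^ (2 * H - 2)
      ≤ ((u / H) / (1 + u / H)) ^ (2 * H - 2) :=
        Real.rpow_le_rpow_of_nonpos (by positivity) hlow (by linarith)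
    _ = (u / H) ^ (2 * H - 2) * (1 + u / H) ^ (2 - 2 * H) := by
        rw [Real.div_rpow hx.le (by positivity), div_eq_mul_inv,
          ← Real.rpow_neg (by positivity), neg_sub]
    _ ≤ (u / H) ^ (2 * H - 2) * (1 + u / H) ^ 2 := by
        gcongr
        rw [← Real.rpow_two]
        exact Real.rpow_le_rpow_of_exponent_le (by linarith) (by linarith)

theorem integrable_one_add_abs_mul_stationaryKernel {H : ℝ} (hH : H ∈ Ioo (1 / 2 : ℝ) 1) :
    Integrable (fun u => (1 + |u|) * stationaryKernel H u) := by
  obtain ⟨hH0, hH1⟩ := hH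
  have hpos : 0 < H := by linarith
  have hb : 0 < 1 / H - 1 := by
    rw [sub_pos, lt_div_iff₀ hpos]
    linarith
  have hterm (k : ℕ) : IntegrableOn
      (fun u : ℝ => u ^ (2 * H - 2 + k) * Real.exp (-(1 / H - 1) * u ^ (1 : ℝ))) (Ioi 0) :=
    integrableOn_rpow_mul_exp_neg_mul_rpow
      (by have : (0 : ℝ) ≤ k := k.cast_nonneg
          linarith) one_pos hb
  have hsum : IntegrableOn (fun u : ℝ => (1 + u) * (Real.exp ((1 - 1 / H) * u) *
      ((u / H) ^ (2 * H - 2) * (1 + u / H) ^ 2))) (Ioi 0) := by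
    have h := ((((hterm 0).add ((hterm 1).const_mul (1 + 2 / H))).add
      ((hterm 2).const_mul (2 / H + 1 / H ^ 2))).add
      ((hterm 3).const_mul (1 / H ^ 2))).const_mul ((1 / H) ^ (2 * H - 2))
    refine IntegrableOn.congr_fun h (fun u (hu : 0 < u) => ?_) measurableSet_Ioi
    simp only [Pi.add_apply, Real.rpow_add_natCast hu.ne', Real.rpow_one]
    rw [div_eq_mul_one_div u H, Real.mul_rpow hu.le (by positivity), neg_sub]
    field_simp
    ring
  have hon : IntegrableOn (fun u => (1 + u) * stationaryKernel H u) (Ioi 0) := by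
    refine Integrable.mono' hsum ?_ ?_
    · exact ((measurable_const.add measurable_id).mul
        (measurable_stationaryKernel H)).aestronglyMeasurable
    · filter_upwards [ae_restrict_mem measurableSet_Ioi] with u (hu : 0 < u)
      rw [Real.norm_of_nonneg (mul_nonneg (by linarith) (stationaryKernel_nonneg hpos u))]
      gcongr
      exact stationaryKernel_le hpos hH1 hu
  simpa [stationaryKernel] using integrable_comp_abs hon

theorem integrable_one_add_two_mul_abs_mul_exp {α : ℝ} (hα : 0 < α) :
    Integrable (fun u => (1 + 2 * |u|) * Real.exp (-α * |u|)) := by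
  have hterm (k : ℕ) : IntegrableOn
      (fun u : ℝ => u ^ (k : ℝ) * Real.exp (-α * u ^ (1 : ℝ))) (Ioi 0) :=
    integrableOn_rpow_mul_exp_neg_mul_rpow
      (by have : (0 : ℝ) ≤ k := k.cast_nonneg
          linarith) one_pos hα
  refine integrable_comp_abs (f := fun u => (1 + 2 * u) * Real.exp (-α * u)) ?_
  refine IntegrableOn.congr_fun ((hterm 0).add ((hterm 1).const_mul 2))
    (fun u _ => ?_) measurableSet_Ioi
  simp only [Pi.add_apply, Real.rpow_natCast, Real.rpow_one]
  ring

theorem integrable_kernel_majorant {H α : ℝ} (hH : H ∈ Ioo (1 / 2 : ℝ) 1) (hα : 0 < α) :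
    Integrable (fun q : ℝ × ℝ × ℝ => ((1 + |q.1|) * stationaryKernel H q.1) *
      (((1 + 2 * |q.2.1|) * Real.exp (-α * |q.2.1|)) *
        ((1 + |q.2.1 - q.2.2|) * stationaryKernel H (q.2.1 - q.2.2)))) := by
  have hg := integrable_one_add_abs_mul_stationaryKernel hH
  have h2 := (integrable_one_add_two_mul_abs_mul_exp hα).mul_prod hg
  let f : ℝ × ℝ →ₗ[ℝ] ℝ × ℝ :=
    (LinearMap.fst ℝ ℝ ℝ).prod (LinearMap.fst ℝ ℝ ℝ - LinearMap.snd ℝ ℝ ℝ)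
  have hf : Function.Involutive f := fun x => by ext <;> simp [f]
  have h3 := (integrable_comp_of_linear_involutive _ f hf _).2 h2
  exact hg.mul_prod h3

/-- The positive octant of `ℝ³`. -/
abbrev octant : Set (ℝ × ℝ × ℝ) := Ioi 0 ×ˢ Ioi 0 ×ˢ Ioi 0

theorem measurableSet_octant : MeasurableSet octant :=
  measurableSet_Ioi.prod (measurableSet_Ioi.prod measurableSet_Ioi)

theorem Ffun_nonneg (H α y₁ y₂ y₃ : ℝ) : 0 ≤ Ffun H α y₁ y₂ y₃ := by
  unfold Ffun
  positivity

theorem integrableOn_Ffun_mul_one_add {H α : ℝ} (hH : H ∈ Ioo (1 / 2 : ℝ) 1) (hα : 0 < α) :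
    IntegrableOn (fun q : ℝ × ℝ × ℝ =>
      Ffun H α q.1 q.2.1 q.2.2 * (1 + q.1 + q.2.1 + q.2.2)) octant := by
  have hpos : 0 < H := by linarith [hH.1]
  refine Integrable.mono' (integrable_kernel_majorant hH hα).integrableOn ?_ ?_
  · exact ((measurable_Ffun H α).mul (by fun_prop)).aestronglyMeasurable
  · filter_upwards [ae_restrict_mem measurableSet_octant] with ⟨a, b, c⟩ ⟨ha, hb, hc⟩
    simp only [mem_Ioi] at ha hb hc
    have hF := Ffun_nonneg H α a b c
    rw [Real.norm_of_nonneg (by positivity), Ffun_eq hpos, abs_of_pos ha, abs_of_pos hb]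
    have hexp : Real.exp (-α * |a - c|) ≤ 1 :=
      Real.exp_le_one_iff.2 (by nlinarith [abs_nonneg (a - c)])
    have hk₁ := stationaryKernel_nonneg hpos a
    have hk₂ := stationaryKernel_nonneg hpos (b - c)
    have hd : c ≤ b + |b - c| := by linarith [neg_abs_le (b - c)]
    have hd0 := abs_nonneg (b - c)
    have hw : 1 + a + b + c ≤ (1 + a) * ((1 + 2 * b) * (1 + |b - c|)) := by
      have h1 : 0 ≤ b * |b - c| := by positivity
      have h2 : 0 ≤ a * (2 * b + |b - c| + 2 * (b * |b - c|)) := by positivity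
      linarith
    calc _ ≤ 1 * Real.exp (-α * b) * stationaryKernel H a * stationaryKernel H (b - c) *
          ((1 + a) * ((1 + 2 * b) * (1 + |b - c|))) := by gcongr
      _ = _ := by ring

theorem integrableOn_Ffun {H α : ℝ} (hH : H ∈ Ioo (1 / 2 : ℝ) 1) (hα : 0 < α) :
    IntegrableOn (fun q : ℝ × ℝ × ℝ => Ffun H α q.1 q.2.1 q.2.2) octant := by
  refine Integrable.mono' (integrableOn_Ffun_mul_one_add hH hα)
    (measurable_Ffun H α).aestronglyMeasurable ?_
  filter_upwards [ae_restrict_mem measurableSet_octant] with ⟨a, b, c⟩ ⟨ha, hb, hc⟩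
  simp only [mem_Ioi] at ha hb hc
  have hF := Ffun_nonneg H α a b c
  rw [Real.norm_of_nonneg hF]
  exact le_mul_of_one_le_right hF (by linarith)

/-- The points `(t, y)` with `t < T` and `0 < yᵢ < t`. -/
def truncatedCone (T : ℝ) : Set (ℝ × ℝ × ℝ × ℝ) :=
  {p | p.1 < T ∧ p.2 ∈ octant ∧ p.2.1 < p.1 ∧ p.2.2.1 < p.1 ∧ p.2.2.2 < p.1}

theorem measurableSet_truncatedCone (T : ℝ) : MeasurableSet (truncatedCone T) := by
  have h₀ : MeasurableSet {p : ℝ × ℝ × ℝ × ℝ | p.1 < T} :=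
    measurableSet_lt measurable_fst measurable_const
  have h₁ : MeasurableSet {p : ℝ × ℝ × ℝ × ℝ | p.2.1 < p.1} :=
    measurableSet_lt (by fun_prop) (by fun_prop)
  have h₂ : MeasurableSet {p : ℝ × ℝ × ℝ × ℝ | p.2.2.1 < p.1} :=
    measurableSet_lt (by fun_prop) (by fun_prop)
  have h₃ : MeasurableSet {p : ℝ × ℝ × ℝ × ℝ | p.2.2.2 < p.1} :=
    measurableSet_lt (by fun_prop) (by fun_prop)
  exact h₀.inter ((measurable_snd measurableSet_octant).inter (h₁.inter (h₂.inter h₃)))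

theorem integrable_indicator_truncatedCone {G : ℝ × ℝ × ℝ → ℝ} (hG : IntegrableOn G octant)
    (T : ℝ) : Integrable ((truncatedCone T).indicator fun p => G p.2) := by
  have h1 : Integrable ((Ioo 0 T).indicator fun _ : ℝ => (1 : ℝ)) :=
    (integrable_indicator_iff measurableSet_Ioo).2 (integrableOn_const (by simp))
  have h2 : Integrable (octant.indicator G) :=
    (integrable_indicator_iff measurableSet_octant).2 hG
  have h := (h1.mul_prod h2).indicator (measurableSet_truncatedCone T)
  refine h.congr (Filter.Eventually.of_forall fun p => ?_)
  by_cases hp : p ∈ truncatedCone T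
  · have ht : p.1 ∈ Ioo 0 T := ⟨lt_trans hp.2.1.1 hp.2.2.1, hp.1⟩
    simp [indicator_of_mem hp, indicator_of_mem ht, indicator_of_mem hp.2.1]
  · simp [indicator_of_notMem hp]

theorem integral_indicator_truncatedCone {G : ℝ × ℝ × ℝ → ℝ} (hG : IntegrableOn G octant)
    (T : ℝ) : ∫ p, (truncatedCone T).indicator (fun p => G p.2) p =
      ∫ y in octant, G y * max (T - max y.1 (max y.2.1 y.2.2)) 0 := by
  refine (integral_prod_symm _ (integrable_indicator_truncatedCone hG T)).trans ?_
  rw [← integral_indicator measurableSet_octant]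
  refine integral_congr_ae (Filter.Eventually.of_forall fun y => ?_)
  by_cases hy : y ∈ octant
  · have hfun : (fun t => (truncatedCone T).indicator (fun p => G p.2) (t, y)) =
        (Ioo (max y.1 (max y.2.1 y.2.2)) T).indicator fun _ => G y := by
      ext t
      have hiff : (t, y) ∈ truncatedCone T ↔ t ∈ Ioo (max y.1 (max y.2.1 y.2.2)) T := by
        simp only [truncatedCone, mem_ofPred_eq, hy, mem_Ioo, max_lt_iff, true_and]
        tauto
      simp only [indicator, hiff]
    simp only [hfun, indicator_of_mem hy]
    rw [integral_indicator measurableSet_Ioo, setIntegral_const, Real.volume_real_Ioo,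
      smul_eq_mul, mul_comm]
  · have hfun : (fun t => (truncatedCone T).indicator (fun p => G p.2) (t, y)) = 0 := by
      ext t
      exact indicator_of_notMem (fun h => hy h.2.1) _
    simp only [hfun, indicator_of_notMem hy]
    simp

theorem abs_integral_truncatedCone_sub_le {G : ℝ × ℝ × ℝ → ℝ} (hG0 : ∀ y, 0 ≤ G y)
    (hG : IntegrableOn G octant)
    (hG' : IntegrableOn (fun y => G y * (1 + y.1 + y.2.1 + y.2.2)) octant) {T : ℝ} (hT : 0 < T) :
    |(∫ p, (truncatedCone T).indicator (fun p => G p.2) p) - T * ∫ y in octant, G y| ≤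
      ∫ y in octant, G y * (1 + y.1 + y.2.1 + y.2.2) := by
  have hint : IntegrableOn (fun y => G y * max (T - max y.1 (max y.2.1 y.2.2)) 0) octant := by
    refine Integrable.mono' (hG.mul_const T) (hG.aestronglyMeasurable.mul
      (by fun_prop : Measurable fun y : ℝ × ℝ × ℝ =>
        max (T - max y.1 (max y.2.1 y.2.2)) 0).aestronglyMeasurable) ?_
    filter_upwards [ae_restrict_mem measurableSet_octant] with y ⟨ha, hb, hc⟩
    have hM : 0 < max y.1 (max y.2.1 y.2.2) := lt_max_of_lt_left ha
    rw [Real.norm_of_nonneg (mul_nonneg (hG0 y) (le_max_right _ _))]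
    exact mul_le_mul_of_nonneg_left (max_le (by linarith) hT.le) (hG0 y)
  rw [integral_indicator_truncatedCone hG, ← integral_const_mul,
    ← integral_sub hint (hG.const_mul T), ← Real.norm_eq_abs]
  refine norm_integral_le_of_norm_le hG' ?_
  filter_upwards [ae_restrict_mem measurableSet_octant] with y ⟨ha, hb, hc⟩
  simp only [mem_Ioi] at ha hb hc
  have hM : max y.1 (max y.2.1 y.2.2) ≤ y.1 + y.2.1 + y.2.2 :=
    max_le (by linarith) (max_le (by linarith) (by linarith))
  have hM0 : 0 < max y.1 (max y.2.1 y.2.2) := lt_max_of_lt_left ha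
  rw [mul_comm T, ← mul_sub, norm_mul, Real.norm_of_nonneg (hG0 y), Real.norm_eq_abs]
  refine mul_le_mul_of_nonneg_left (abs_le.2 ⟨?_, ?_⟩) (hG0 y)
  · linarith [le_max_left (T - max y.1 (max y.2.1 y.2.2)) 0]
  · linarith [max_le (by linarith : T - max y.1 (max y.2.1 y.2.2) ≤ T) hT.le]

/-- The coordinates `(x₁, x₂, x₃, x₄) ↦ (x₁, x₁ - x₂, x₁ - x₃, x₁ - x₄)`. -/
def diffCoords : ℝ × ℝ × ℝ × ℝ →ₗ[ℝ] ℝ × ℝ × ℝ × ℝ where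
  toFun p := (p.1, p.1 - p.2.1, p.1 - p.2.2.1, p.1 - p.2.2.2)
  map_add' p q := by ext <;> simp <;> ring
  map_smul' c p := by ext <;> simp <;> ring

theorem diffCoords_involutive : Function.Involutive diffCoords := fun p => by
  ext <;> simp [diffCoords]

/-- The permutation `(x₁ x₂)(x₃ x₄)` of the coordinates. -/
def swapAdjacent : ℝ × ℝ × ℝ × ℝ →ₗ[ℝ] ℝ × ℝ × ℝ × ℝ where
  toFun p := (p.2.1, p.1, p.2.2.2, p.2.2.1)
  map_add' _ _ := rfl
  map_smul' _ _ := rfl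

/-- The permutation `(x₁ x₃)(x₂ x₄)` of the coordinates. -/
def swapPairs : ℝ × ℝ × ℝ × ℝ →ₗ[ℝ] ℝ × ℝ × ℝ × ℝ where
  toFun p := (p.2.2.1, p.2.2.2, p.1, p.2.1)
  map_add' _ _ := rfl
  map_smul' _ _ := rfl

/-- The permutation `(x₁ x₄)(x₂ x₃)` of the coordinates. -/
def reverseCoords : ℝ × ℝ × ℝ × ℝ →ₗ[ℝ] ℝ × ℝ × ℝ × ℝ where
  toFun p := (p.2.2.2, p.2.2.1, p.2.1, p.1)
  map_add' _ _ := rfl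
  map_smul' _ _ := rfl

theorem rker_comm (H w z : ℝ) : rker H w z = rker H z w := by
  rw [rker, rker, abs_sub_comm, mul_comm (Real.exp (w / H))]

theorem mker_swapAdjacent (H α a b c d : ℝ) : mker H α b a d c = mker H α a b c d := by
  rw [mker, mker, rker_comm H b a, rker_comm H d c]
  ring

theorem mker_swapPairs (H α a b c d : ℝ) : mker H α c d a b = mker H α a b c d := by
  rw [mker, mker, abs_sub_comm c a, abs_sub_comm d b]
  ring

theorem mker_reverseCoords (H α a b c d : ℝ) : mker H α d c b a = mker H α a b c d := by
  rw [mker_swapPairs, mker_swapAdjacent]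

/-- The open cube `(0, T)⁴`. -/
abbrev openCube (T : ℝ) : Set (ℝ × ℝ × ℝ × ℝ) := Ioo 0 T ×ˢ Ioo 0 T ×ˢ Ioo 0 T ×ˢ Ioo 0 T

/-- The restriction of `mker` to the points of the cube whose first coordinate is the largest. -/
noncomputable def mkerFirstLargest (H α T : ℝ) (p : ℝ × ℝ × ℝ × ℝ) : ℝ :=
  {p | diffCoords p ∈ truncatedCone T}.indicator
    (fun p => mker H α p.1 p.2.1 p.2.2.1 p.2.2.2) p

theorem diffCoords_mem_truncatedCone {T a b c d : ℝ} :
    diffCoords (a, b, c, d) ∈ truncatedCone T ↔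
      a < T ∧ (b < a ∧ c < a ∧ d < a) ∧ 0 < b ∧ 0 < c ∧ 0 < d := by
  simp [diffCoords, truncatedCone]

theorem mkerFirstLargest_eq {H : ℝ} (hH : 0 < H) (α T : ℝ) (p : ℝ × ℝ × ℝ × ℝ) :
    mkerFirstLargest H α T p = H ^ (4 * H - 2) * (2 * H - 1) ^ 2 *
      (truncatedCone T).indicator (fun p => Ffun H α p.2.1 p.2.2.1 p.2.2.2) (diffCoords p) := by
  by_cases hp : diffCoords p ∈ truncatedCone T
  · have h := mker_sub hH α p.1 (p.1 - p.2.1) (p.1 - p.2.2.1) (p.1 - p.2.2.2) hp.2.1.2.1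
    simp only [sub_sub_cancel] at h
    rw [mkerFirstLargest, indicator_of_mem (by exact hp), indicator_of_mem hp, h]
    rfl
  · rw [mkerFirstLargest, indicator_of_notMem (by exact hp), indicator_of_notMem hp, mul_zero]

theorem indicator_openCube_mker (H α T : ℝ) {a b c d : ℝ} (hab : a ≠ b) (hac : a ≠ c)
    (had : a ≠ d) (hbc : b ≠ c) (hbd : b ≠ d) (hcd : c ≠ d) :
    (openCube T).indicator (fun p => mker H α p.1 p.2.1 p.2.2.1 p.2.2.2) (a, b, c, d) =
      mkerFirstLargest H α T (a, b, c, d) + mkerFirstLargest H α T (b, a, d, c) +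
      mkerFirstLargest H α T (c, d, a, b) + mkerFirstLargest H α T (d, c, b, a) := by
  simp only [mkerFirstLargest, indicator, mem_ofPred_eq, diffCoords_mem_truncatedCone,
    mker_swapAdjacent H α a b c d, mker_swapPairs H α a b c d, mker_reverseCoords H α a b c d,
    mem_prod, mem_Ioo]
  generalize mker H α a b c d = m
  rcases lt_or_gt_of_ne hab with h₁ | h₁ <;> rcases lt_or_gt_of_ne hac with h₂ | h₂ <;>
    rcases lt_or_gt_of_ne had with h₃ | h₃ <;> rcases lt_or_gt_of_ne hbc with h₄ | h₄ <;>
    rcases lt_or_gt_of_ne hbd with h₅ | h₅ <;> rcases lt_or_gt_of_ne hcd with h₆ | h₆ <;>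
    grind

theorem ae_linear_ne_linear {k l : ℝ × ℝ × ℝ × ℝ →ₗ[ℝ] ℝ} (hkl : k ≠ l) :
    ∀ᵐ p : ℝ × ℝ × ℝ × ℝ, k p ≠ l p := by
  filter_upwards [ae_linear_ne_zero volume (k - l) (sub_ne_zero.2 hkl)] with p hp
  simpa [sub_eq_zero] using hp

theorem ae_pairwise_ne : ∀ᵐ p : ℝ × ℝ × ℝ × ℝ,
    p.1 ≠ p.2.1 ∧ p.1 ≠ p.2.2.1 ∧ p.1 ≠ p.2.2.2 ∧
      p.2.1 ≠ p.2.2.1 ∧ p.2.1 ≠ p.2.2.2 ∧ p.2.2.1 ≠ p.2.2.2 := by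
  let l₁ : ℝ × ℝ × ℝ × ℝ →ₗ[ℝ] ℝ := LinearMap.fst ℝ ℝ _
  let l₂ : ℝ × ℝ × ℝ × ℝ →ₗ[ℝ] ℝ := LinearMap.fst ℝ ℝ _ ∘ₗ LinearMap.snd ℝ ℝ _
  let l₃ : ℝ × ℝ × ℝ × ℝ →ₗ[ℝ] ℝ :=
    LinearMap.fst ℝ ℝ _ ∘ₗ LinearMap.snd ℝ ℝ _ ∘ₗ LinearMap.snd ℝ ℝ _
  let l₄ : ℝ × ℝ × ℝ × ℝ →ₗ[ℝ] ℝ :=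
    LinearMap.snd ℝ ℝ _ ∘ₗ LinearMap.snd ℝ ℝ _ ∘ₗ LinearMap.snd ℝ ℝ _
  have hne {k l : ℝ × ℝ × ℝ × ℝ →ₗ[ℝ] ℝ} (h : k (1, 2, 3, 4) ≠ l (1, 2, 3, 4)) :=
    ae_linear_ne_linear (fun hkl : k = l => h (by rw [hkl]))
  filter_upwards [hne (k := l₁) (l := l₂) (by norm_num [l₁, l₂]),
    hne (k := l₁) (l := l₃) (by norm_num [l₁, l₃]), hne (k := l₁) (l := l₄) (by norm_num [l₁, l₄]),
    hne (k := l₂) (l := l₃) (by norm_num [l₂, l₃]), hne (k := l₂) (l := l₄) (by norm_num [l₂, l₄]),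
    hne (k := l₃) (l := l₄) (by norm_num [l₃, l₄])] with p h₁ h₂ h₃ h₄ h₅ h₆
  exact ⟨h₁, h₂, h₃, h₄, h₅, h₆⟩

theorem setIntegral_openCube_mker {H α : ℝ} (hH : H ∈ Ioo (1 / 2 : ℝ) 1) (hα : 0 < α) (T : ℝ) :
    ∫ p in openCube T, mker H α p.1 p.2.1 p.2.2.1 p.2.2.2 =
      4 * (H ^ (4 * H - 2) * (2 * H - 1) ^ 2 *
        ∫ p, (truncatedCone T).indicator (fun p => Ffun H α p.2.1 p.2.2.1 p.2.2.2) p) := by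
  have hpos : 0 < H := by linarith [hH.1]
  have hcone := integrable_indicator_truncatedCone (integrableOn_Ffun hH hα) T
  have heq := funext (mkerFirstLargest_eq hpos α T)
  have hint : Integrable (mkerFirstLargest H α T) := by
    rw [heq]
    exact ((integrable_comp_of_linear_involutive volume _ diffCoords_involutive _).2
      hcone).const_mul _
  have hval : ∫ p, mkerFirstLargest H α T p = H ^ (4 * H - 2) * (2 * H - 1) ^ 2 *
      ∫ p, (truncatedCone T).indicator (fun p => Ffun H α p.2.1 p.2.2.1 p.2.2.2) p := by
    rw [heq, integral_const_mul]
    exact congrArg _ (integral_comp_of_linear_involutive volume _ diffCoords_involutive _)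
  have hcomp {σ : ℝ × ℝ × ℝ × ℝ →ₗ[ℝ] ℝ × ℝ × ℝ × ℝ} (hσ : Function.Involutive σ) :=
    (integrable_comp_of_linear_involutive volume σ hσ _).2 hint
  have h₁ := hcomp (σ := swapAdjacent) fun _ => rfl
  have h₂ := hcomp (σ := swapPairs) fun _ => rfl
  have h₃ := hcomp (σ := reverseCoords) fun _ => rfl
  have h₀₁ : Integrable (fun p => mkerFirstLargest H α T p +
      mkerFirstLargest H α T (swapAdjacent p)) := hint.add h₁
  have h₀₁₂ : Integrable (fun p => mkerFirstLargest H α T p +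
      mkerFirstLargest H α T (swapAdjacent p) + mkerFirstLargest H α T (swapPairs p)) := h₀₁.add h₂
  have hsplit : (openCube T).indicator (fun p => mker H α p.1 p.2.1 p.2.2.1 p.2.2.2) =ᵐ[volume]
      fun p => mkerFirstLargest H α T p + mkerFirstLargest H α T (swapAdjacent p) +
        mkerFirstLargest H α T (swapPairs p) + mkerFirstLargest H α T (reverseCoords p) := by
    filter_upwards [ae_pairwise_ne] with p ⟨hab, hac, had, hbc, hbd, hcd⟩
    exact indicator_openCube_mker H α T hab hac had hbc hbd hcd
  have hcube : MeasurableSet (openCube T) :=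
    measurableSet_Ioo.prod (measurableSet_Ioo.prod (measurableSet_Ioo.prod measurableSet_Ioo))
  rw [← integral_indicator hcube, integral_congr_ae hsplit, integral_add h₀₁₂ h₃,
    integral_add h₀₁ h₂, integral_add hint h₁,
    integral_comp_of_linear_involutive volume swapAdjacent (fun _ => rfl),
    integral_comp_of_linear_involutive volume swapPairs (fun _ => rfl),
    integral_comp_of_linear_involutive volume reverseCoords (fun _ => rfl), hval]
  ring

theorem stmt14 (H α : ℝ) (hH : H ∈ Set.Ioo (1/2 : ℝ) 1) (hα : 0 < α) :
    ∃ C : ℝ, 0 < C ∧ ∀ T : ℝ, 0 < T →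
      |(1 / (4 * T)) *
          (∫ p in (Set.Ioo (0:ℝ) T ×ˢ Set.Ioo (0:ℝ) T ×ˢ Set.Ioo (0:ℝ) T ×ˢ Set.Ioo (0:ℝ) T),
            mker H α p.1 p.2.1 p.2.2.1 p.2.2.2)
        - H ^ (4 * H - 2) * (2 * H - 1) ^ 2 *
          (∫ q in (Set.Ioi (0:ℝ) ×ˢ Set.Ioi (0:ℝ) ×ˢ Set.Ioi (0:ℝ)),
            Ffun H α q.1 q.2.1 q.2.2)| ≤ C / T := by
  have hpos : 0 < H := by linarith [hH.1]
  set c := H ^ (4 * H - 2) * (2 * H - 1) ^ 2 with hc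
  have hc0 : 0 ≤ c := by positivity
  set M := ∫ q in octant, Ffun H α q.1 q.2.1 q.2.2 * (1 + q.1 + q.2.1 + q.2.2)
  refine ⟨c * |M| + 1, by positivity, fun T hT => ?_⟩
  have hbound := abs_integral_truncatedCone_sub_le (fun q => Ffun_nonneg H α q.1 q.2.1 q.2.2)
    (integrableOn_Ffun hH hα) (integrableOn_Ffun_mul_one_add hH hα) hT
  rw [setIntegral_openCube_mker hH hα T, ← hc]
  set A := ∫ p, (truncatedCone T).indicator (fun p => Ffun H α p.2.1 p.2.2.1 p.2.2.2) p
  set B := ∫ q in octant, Ffun H α q.1 q.2.1 q.2.2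
  have hfactor : 1 / (4 * T) * (4 * (c * A)) - c * B = c * (A - T * B) / T := by
    field_simp
  rw [hfactor, abs_div, abs_mul, abs_of_nonneg hc0, abs_of_pos hT]
  gcongr
  calc c * |A - T * B| ≤ c * |M| :=
        mul_le_mul_of_nonneg_left (hbound.trans (le_abs_self M)) hc0
    _ ≤ c * |M| + 1 := by linarith
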